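/- For every real number s > 2, the Dirichlet series identity 2 ζ(s − 1) · ∑_{n ≥ 1} δ(n)/n^s = ∑_{n ≥ 1} δ(n) τ(n)/n^s holds, where ζ is the Riemann zeta function (both series being convergent for s > 2). -/

import Mathlib

open ArithmeticFunction

/-- The arithmetic derivative: `δ(n) = ∑_{p | n} ν_p(n) · (n / p)`,
equivalently `δ(n) = n · ∑_{p^α ∥ n} α / p`, with `δ(0) = 0`. -/
def arithDeriv : ArithmeticFunction ℕ :=
  ⟨fun n => ∑ p ∈ n.primeFactors, n.factorization p * (n / p), by simp⟩

theorem arithDeriv_eq_sum_of_subset {n : ℕ} {t : Finset ℕ} (h : n.primeFactors ⊆ t) :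
    arithDeriv n = ∑ p ∈ t, n.factorization p * (n / p) := by
  refine Finset.sum_subset h fun p _ hp => ?_
  rw [← Nat.support_factorization, Finsupp.notMem_support_iff] at hp
  simp [hp]

theorem factorization_mul_mul_div (a b p : ℕ) :
    a.factorization p * (a * b / p) = a.factorization p * (a / p) * b := by
  by_cases h : p ∣ a
  · rw [mul_comm a b, Nat.mul_div_assoc b h]
    ring
  · simp [Nat.factorization_eq_zero_of_not_dvd h]

theorem arithDeriv_mul {a b : ℕ} (ha : a ≠ 0) (hb : b ≠ 0) :
    arithDeriv (a * b) = arithDeriv a * b + a * arithDeriv b := by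
  have hsub := Nat.primeFactors_mul ha hb
  rw [arithDeriv_eq_sum_of_subset (Finset.Subset.refl (a * b).primeFactors),
    arithDeriv_eq_sum_of_subset (n := a) (t := (a * b).primeFactors)
      (hsub ▸ Finset.subset_union_left),
    arithDeriv_eq_sum_of_subset (n := b) (t := (a * b).primeFactors)
      (hsub ▸ Finset.subset_union_right),
    Finset.sum_mul, Finset.mul_sum, ← Finset.sum_add_distrib]
  refine Finset.sum_congr rfl fun p _ => ?_
  rw [Nat.factorization_mul ha hb, Finsupp.add_apply, add_mul, factorization_mul_mul_div,
    mul_comm a b, factorization_mul_mul_div]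
  ring

/-- The arithmetic derivative satisfies `2 (id * δ) = δ τ`, with `*` the Dirichlet convolution. -/
theorem two_mul_id_mul_arithDeriv (n : ℕ) :
    2 * (ArithmeticFunction.id * arithDeriv) n = arithDeriv n * sigma 0 n := by
  have hswap : (ArithmeticFunction.id * arithDeriv) n =
      ∑ x ∈ n.divisorsAntidiagonal, arithDeriv x.1 * x.2 := by
    rw [mul_comm, ArithmeticFunction.mul_apply]
    rfl
  rw [two_mul]
  nth_rewrite 1 [hswap]
  rw [ArithmeticFunction.mul_apply, ← Finset.sum_add_distrib,
    Finset.sum_congr rfl (g := fun _ => arithDeriv n)]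
  · rw [Finset.sum_const, smul_eq_mul, mul_comm, sigma_zero_apply,
      ← Nat.map_div_right_divisors, Finset.card_map]
  · intro x hx
    obtain ⟨rfl, hn⟩ := Nat.mem_divisorsAntidiagonal.mp hx
    rw [arithDeriv_mul (left_ne_zero_of_mul hn) (right_ne_zero_of_mul hn)]
    rfl

theorem arithDeriv_le_mul_log (n : ℕ) : (arithDeriv n : ℝ) ≤ n * Real.log n := by
  rcases eq_or_ne n 0 with rfl | hn
  · simp
  have hlog : Real.log n = ∑ p ∈ n.primeFactors, n.factorization p * Real.log p :=
    Real.log_nat_eq_sum_factorization n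
  rw [arithDeriv_eq_sum_of_subset (Finset.Subset.refl _), hlog, Finset.mul_sum, Nat.cast_sum]
  refine Finset.sum_le_sum fun p hp => ?_
  have hp2 : (2 : ℝ) ≤ p := by exact_mod_cast (Nat.prime_of_mem_primeFactors hp).two_le
  have hinv : (p : ℝ)⁻¹ ≤ Real.log p := by
    have h1 : (p : ℝ)⁻¹ ≤ 2⁻¹ := by gcongr
    have h2 : Real.log 2 ≤ Real.log p := Real.log_le_log (by norm_num) hp2
    linarith [Real.log_two_gt_d9]
  calc ((n.factorization p * (n / p) : ℕ) : ℝ)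
      ≤ n.factorization p * (n * (p : ℝ)⁻¹) := by
        rw [Nat.cast_mul, ← div_eq_mul_inv]
        gcongr
        exact Nat.cast_div_le
    _ ≤ n.factorization p * (n * Real.log p) := by gcongr
    _ = n * (n.factorization p * Real.log p) := by ring

theorem lSeriesSummable_arithDeriv {s : ℂ} (hs : 2 < s.re) :
    LSeriesSummable (fun n => (arithDeriv n : ℂ)) s := by
  set ε := (s.re - 2) / 2 with hε
  have hε0 : 0 < ε := by linarith
  refine LSeriesSummable_of_le_const_mul_rpow (x := 2 + ε) (by linarith)
    ⟨ε⁻¹, fun n hn => ?_⟩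
  have hn0 : (0 : ℝ) < n := by exact_mod_cast Nat.pos_of_ne_zero hn
  rw [Complex.norm_natCast]
  calc (arithDeriv n : ℝ) ≤ n * Real.log n := arithDeriv_le_mul_log n
    _ ≤ n * ((n : ℝ) ^ ε / ε) := by
        gcongr
        exact Real.log_le_rpow_div hn0.le hε0
    _ = ε⁻¹ * (n : ℝ) ^ (2 + ε - 1) := by
        rw [show 2 + ε - 1 = 1 + ε by ring, Real.rpow_add hn0, Real.rpow_one]
        ring

theorem term_natCast_eq (s : ℂ) (n : ℕ) :
    LSeries.term (fun n => (n : ℂ)) s n = if n = 0 then 0 else 1 / (n : ℂ) ^ (s - 1) := by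
  rw [LSeries.term_def]
  split_ifs with hn
  · rfl
  · have hn' : (n : ℂ) ≠ 0 := Nat.cast_ne_zero.mpr hn
    rw [Complex.cpow_sub _ _ hn', Complex.cpow_one, one_div_div]

theorem lSeriesSummable_natCast {s : ℂ} (hs : 2 < s.re) :
    LSeriesSummable (fun n => (n : ℂ)) s := by
  refine LSeriesSummable_of_le_const_mul_rpow (x := 2) hs ⟨1, fun n _ => ?_⟩
  norm_num

theorem lSeries_natCast {s : ℂ} (hs : 2 < s.re) :
    LSeries (fun n => (n : ℂ)) s = riemannZeta (s - 1) := by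
  have hs1 : 1 < (s - 1).re := by
    rw [Complex.sub_re, Complex.one_re]
    linarith
  rw [zeta_eq_tsum_one_div_nat_cpow hs1, LSeries]
  refine tsum_congr fun n => ?_
  rw [term_natCast_eq]
  split_ifs with hn
  · have : s - 1 ≠ 0 := Complex.ne_zero_of_one_lt_re hs1
    simp [hn, this]
  · rfl

theorem lSeries_eq_tsum_div {f : ℕ → ℂ} (hf : f 0 = 0) (s : ℂ) :
    LSeries f s = ∑' n : ℕ, f n / (n : ℂ) ^ s := by
  refine tsum_congr fun n => ?_
  rw [LSeries.term_def]
  split_ifs with hn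
  · simp [hn, hf]
  · rfl

/-- For real `s > 2`:
`2 ζ(s − 1) · ∑_{n ≥ 1} δ(n)/n^s = ∑_{n ≥ 1} δ(n) τ(n)/n^s`. -/
theorem two_zeta_mul_dirichlet_series_arithDeriv (s : ℝ) (hs : 2 < s) :
    2 * riemannZeta ((s : ℂ) - 1) * ∑' n : ℕ, (arithDeriv n : ℂ) / (n : ℂ) ^ (s : ℂ) =
      ∑' n : ℕ, ((arithDeriv n : ℂ) * ((sigma 0) n : ℂ)) / (n : ℂ) ^ (s : ℂ) := by
  have hs' : 2 < (s : ℂ).re := hs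
  have hmul := LSeries_mul' (s := (s : ℂ))
    (f := ((ArithmeticFunction.id : ArithmeticFunction ℕ) : ArithmeticFunction ℂ))
    (g := (arithDeriv : ArithmeticFunction ℂ))
    (lSeriesSummable_natCast hs') (lSeriesSummable_arithDeriv hs')
  have hzeta : LSeries (fun n => ((ArithmeticFunction.id : ArithmeticFunction ℕ) :
      ArithmeticFunction ℂ) n) (s : ℂ) = riemannZeta ((s : ℂ) - 1) := lSeries_natCast hs'
  rw [hzeta, lSeries_eq_tsum_div (by simp), lSeries_eq_tsum_div (by simp)] at hmul
  simp only [natCoe_apply] at hmul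
  rw [mul_assoc, ← hmul, ← tsum_mul_left]
  refine tsum_congr fun n => ?_
  rw [← mul_div_assoc, ← natCoe_mul, natCoe_apply]
  congr 1
  exact_mod_cast two_mul_id_mul_arithDeriv n
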